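/- arXiv:2407.05730 — 2 statements merged into one kernel-verified Lean document; each statement's English description precedes it below -/
import Mathlib

section
/- Let k ≥ 2 be an integer. Then for all integers n ≥ k³ − k² + 2k − 1 we have ( C(n−1,k−1) − C(n−k−1,k−1) + 1 ) / C(n−1,k−1) < n / ( k(n−2k+2) ). -/
theorem aux_union (p j q : ℕ) : ∀ t : ℕ, p + t ≤ q + 1 →
    Nat.choose (p + t) (j + 1) ≤ Nat.choose p (j + 1) + t * Nat.choose q j := by
  intro t
  induction t with
  | zero => intro _; simp
  | succ t ih =>
    intro h
    have h1 := ih (by omega)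
    have h2 : Nat.choose (p + t) j ≤ Nat.choose q j := Nat.choose_le_choose j (by omega)
    have h3 : Nat.choose (p + (t + 1)) (j + 1)
        = Nat.choose (p + t) j + Nat.choose (p + t) (j + 1) := Nat.choose_succ_succ _ _
    rw [h3, Nat.succ_mul]
    omega

theorem aux_lower (j : ℕ) : ∀ q : ℕ, j + 1 ≤ q → q + 1 ≤ Nat.choose (q + 1) (j + 1) := by
  intro q hq
  induction q, hq using Nat.le_induction with
  | base => rw [Nat.choose_succ_self_right]
  | succ q hq ih =>
    have h3 : Nat.choose (q + 1 + 1) (j + 1)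
        = Nat.choose (q + 1) j + Nat.choose (q + 1) (j + 1) := Nat.choose_succ_succ _ _
    have : 0 < Nat.choose (q + 1) j := Nat.choose_pos (by omega)
    omega

theorem stmt13 (k n : ℕ) (hk : 2 ≤ k) (hn : k ^ 3 - k ^ 2 + 2 * k - 1 ≤ n) :
    ((Nat.choose (n - 1) (k - 1) : ℚ) - (Nat.choose (n - k - 1) (k - 1) : ℚ) + 1)
        / (Nat.choose (n - 1) (k - 1) : ℚ)
      < (n : ℚ) / ((k : ℚ) * ((n : ℚ) - 2 * k + 2)) := by
  obtain ⟨j, rfl⟩ : ∃ j, k = j + 2 := ⟨k - 2, by omega⟩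
  have hbig : (j + 2) * ((j + 2) * (j + 1) + 1) + (j + 2) ≤ n + 1 := by
    have e : (j + 2) ^ 3 = (j + 2) ^ 2 + (j + 2) ^ 2 * (j + 1) := by ring
    have e2 : (j + 2) * ((j + 2) * (j + 1) + 1) = (j + 2) ^ 2 * (j + 1) + (j + 2) := by ring
    omega
  have hlin : 3 * (j + 2) ≤ (j + 2) * ((j + 2) * (j + 1) + 1) := by
    rw [mul_comm 3]
    exact Nat.mul_le_mul_left _ (by nlinarith)
  obtain ⟨q, rfl⟩ : ∃ q, n = q + 2 := ⟨n - 2, by omega⟩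
  have hA : q + 1 ≤ Nat.choose (q + 1) (j + 1) := aux_lower j q (by omega)
  have hU := aux_union (q + 2 - (j + 2) - 1) j q (j + 2) (by omega)
  have e1 : q + 2 - (j + 2) - 1 + (j + 2) = q + 1 := by omega
  rw [e1] at hU
  have hI := Nat.add_one_mul_choose_eq q j
  have e2 : q + 2 - 1 = q + 1 := by omega
  have e3 : j + 2 - 1 = j + 1 := by omega
  rw [e2, e3]
  have hq : (j + 2) * ((j + 2) * (j + 1) + 1) ≤ q + 1 := by omega
  have hpos : 2 * (j + 2) ≤ q + 2 := by omega
  generalize Nat.choose (q + 1) (j + 1) = A at *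
  generalize Nat.choose (q + 2 - (j + 2) - 1) (j + 1) = B at *
  generalize Nat.choose q j = c at *
  clear e1 e2 e3 hbig hlin hn hk
  have hA' : (q : ℚ) + 1 ≤ A := by exact_mod_cast hA
  have hU' : (A : ℚ) ≤ B + (j + 2) * c := by exact_mod_cast hU
  have hI' : ((q : ℚ) + 1) * c = A * (j + 1) := by exact_mod_cast hI
  have hq' : ((j : ℚ) + 2) * ((j + 2) * (j + 1) + 1) ≤ q + 1 := by exact_mod_cast hq
  have hpos' : 2 * ((j : ℚ) + 2) ≤ q + 2 := by exact_mod_cast hpos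
  have hj : (0 : ℚ) ≤ j := Nat.cast_nonneg j
  have hq0 : (0 : ℚ) < (q : ℚ) + 1 := by positivity
  have hApos : (0 : ℚ) < A := by linarith
  push_cast
  have hD : ((q : ℚ) + 1) * (A - B + 1) ≤ ((j + 2) * (j + 1) + 1) * A := by
    calc ((q : ℚ) + 1) * (A - B + 1) ≤ (q + 1) * ((j + 2) * c + 1) :=
          mul_le_mul_of_nonneg_left (by linarith) hq0.le
      _ = (j + 2) * ((q + 1) * c) + (q + 1) := by ring
      _ ≤ ((j + 2) * (j + 1) + 1) * A := by rw [hI']; linarith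
  have hkD : ((j : ℚ) + 2) * (A - B + 1) ≤ A := by
    refine le_of_mul_le_mul_left ?_ hq0
    calc ((q : ℚ) + 1) * ((j + 2) * (A - B + 1)) = (j + 2) * ((q + 1) * (A - B + 1)) := by ring
      _ ≤ (j + 2) * (((j + 2) * (j + 1) + 1) * A) :=
          mul_le_mul_of_nonneg_left hD (by linarith)
      _ = ((j + 2) * ((j + 2) * (j + 1) + 1)) * A := by ring
      _ ≤ (q + 1) * A := mul_le_mul_of_nonneg_right hq' hApos.le
  have hk0 : (0 : ℚ) < (j : ℚ) + 2 := by linarith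
  have hden : (0 : ℚ) < (q : ℚ) + 2 - 2 * (j + 2) + 2 := by linarith
  have s1 : ((A : ℚ) - B + 1) / A ≤ 1 / (j + 2) := by
    rw [div_le_div_iff₀ hApos hk0]; linarith
  refine lt_of_le_of_lt s1 ?_
  rw [div_lt_div_iff₀ hk0 (mul_pos hk0 hden)]
  nlinarith
end

section
/- Let k ≥ 2 and n ≥ 2k+1 be integers, and define q₀(n,k) := ⌊ (k−1)(n−2k+1)/(n−k) + (k−1)(n−2k)(n−1)·(C(n−2,k−1) − C(n−k−1,k−1)) / ( k(n−k)·(C(n−k−1,k−1) − 1) ) ⌋. Then q₀(n,k) < 4^k · (n − 2k). -/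
theorem key_aux (j m : ℕ) : Nat.choose (2 * j + m) j ≤ Nat.choose (j + m) j * 4 ^ j := by
  induction m with
  | zero =>
    have h := Nat.choose_le_two_pow (2 * j) j
    rw [pow_mul] at h
    simpa using h
  | succ m ih =>
    have h1 := Nat.choose_mul_succ_eq (2 * j + m) j
    have h2 := Nat.choose_mul_succ_eq (j + m) j
    rw [show 2 * j + m + 1 - j = j + m + 1 by omega] at h1
    rw [show j + m + 1 - j = m + 1 by omega] at h2
    rw [← add_assoc, ← add_assoc]
    have h3 : (2 * j + m + 1) * (m + 1) ≤ (j + m + 1) * (j + m + 1) := by nlinarith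
    refine Nat.le_of_mul_le_mul_right (c := (j + m + 1) * (m + 1)) ?_ (by positivity)
    calc (2 * j + m + 1).choose j * ((j + m + 1) * (m + 1))
        = (2 * j + m).choose j * ((2 * j + m + 1) * (m + 1)) := by
          rw [← mul_assoc, ← h1, mul_assoc]
      _ ≤ ((j + m).choose j * 4 ^ j) * ((j + m + 1) * (j + m + 1)) := Nat.mul_le_mul ih h3
      _ = ((j + m).choose j * (j + m + 1)) * (4 ^ j * (j + m + 1)) := by ring
      _ = _ := by rw [h2]; ring

theorem stmt14 (k n : ℕ) (hk : 2 ≤ k) (hn : 2 * k + 1 ≤ n) :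
    ⌊((k : ℚ) - 1) * ((n : ℚ) - 2 * k + 1) / ((n : ℚ) - k)
        + ((k : ℚ) - 1) * ((n : ℚ) - 2 * k) * ((n : ℚ) - 1)
            * ((Nat.choose (n - 2) (k - 1) : ℚ) - (Nat.choose (n - k - 1) (k - 1) : ℚ))
          / ((k : ℚ) * ((n : ℚ) - k) * ((Nat.choose (n - k - 1) (k - 1) : ℚ) - 1))⌋
      < (4 : ℤ) ^ k * ((n : ℤ) - 2 * k) := by
  obtain ⟨j, rfl⟩ : ∃ j, k = j + 1 := ⟨k - 1, by omega⟩
  obtain ⟨m, rfl⟩ : ∃ m, n = 2 * (j + 1) + m := ⟨n - 2 * (j + 1), by omega⟩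
  have hj : 1 ≤ j := by omega
  have hm : 1 ≤ m := by omega
  rw [show 2 * (j + 1) + m - 2 = 2 * j + m by omega,
    show 2 * (j + 1) + m - (j + 1) - 1 = j + m by omega, show j + 1 - 1 = j by omega]
  have hA := key_aux j m
  have hB : j + 1 ≤ Nat.choose (j + m) j := by
    have := Nat.choose_le_choose j (show j + 1 ≤ j + m by omega)
    simpa using this
  generalize Nat.choose (2 * j + m) j = A at *
  generalize Nat.choose (j + m) j = B at *
  have hA' : (A : ℚ) ≤ B * 4 ^ j := by exact_mod_cast hA
  have hB' : (j : ℚ) + 1 ≤ B := by exact_mod_cast hB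
  have hj' : (1 : ℚ) ≤ j := by exact_mod_cast hj
  have hm' : (1 : ℚ) ≤ m := by exact_mod_cast hm
  have hR : (1 : ℚ) ≤ 4 ^ j := one_le_pow₀ (by norm_num)
  rw [Int.floor_lt]
  push_cast
  rw [pow_succ]
  generalize (4 : ℚ) ^ j = R at *
  generalize (A : ℚ) = a at *
  generalize (B : ℚ) = b at *
  generalize (j : ℚ) = x at *
  generalize (m : ℚ) = y at *
  have e1 : (x + 1 - 1) * (2 * (x + 1) + y - 2 * (x + 1) + 1) / (2 * (x + 1) + y - (x + 1))
      < 2 * y := by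
    rw [div_lt_iff₀ (by linarith)]
    nlinarith
  have e2 : (x + 1 - 1) * (2 * (x + 1) + y - 2 * (x + 1)) * (2 * (x + 1) + y - 1) * (a - b) /
      ((x + 1) * (2 * (x + 1) + y - (x + 1)) * (b - 1)) ≤ 2 * y * (R - 1) := by
    have p1 : 0 < x + 1 + y := by linarith
    have p2 : 0 < b - 1 := by linarith
    rw [div_le_iff₀ (by
      rw [show 2 * (x + 1) + y - (x + 1) = x + 1 + y by ring]; positivity)]
    have q1 : a - b ≤ b * (R - 1) := by linarith
    have q2 : x * b ≤ (x + 1) * (b - 1) := by linarith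
    have q3 : 2 * x + 1 + y ≤ 2 * (x + 1 + y) := by linarith
    have r : 0 ≤ R - 1 := by linarith
    calc _ = x * y * (2 * x + 1 + y) * (a - b) := by ring
      _ ≤ x * y * (2 * x + 1 + y) * (b * (R - 1)) := by gcongr
      _ = (x * b) * (2 * x + 1 + y) * (y * (R - 1)) := by ring
      _ ≤ ((x + 1) * (b - 1)) * (2 * (x + 1 + y)) * (y * (R - 1)) := by gcongr
      _ = _ := by ring
  have e3 : 0 < y * R := by positivity
  nlinarith
end
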